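/- Every atomless congestion game possesses a symmetric randomized strategy robust perfect equilibrium and a pure strategy robust perfect equilibrium. -/

import Mathlib

open MeasureTheory Filter Topology

section RobustPerfect

variable {I : Type*} [MeasurableSpace I] {A : Type*} [Fintype A]

/-- The societal summary of a randomized strategy profile. -/
noncomputable def socSum (lam : Measure I) (h : I → A → ℝ) : A → ℝ :=
  fun a => ∫ i, h i a ∂lam

/-- `h` is a randomized strategy profile: a measurable map into the simplex. -/
def IsProfile (lam : Measure I) (h : I → A → ℝ) : Prop :=
  Measurable h ∧ ∀ i, h i ∈ stdSimplex ℝ A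

/-- A large game: payoffs continuous on the simplex and measurable in the player. -/
def IsLargeGame (u : I → A → (A → ℝ) → ℝ) : Prop :=
  (∀ i a, ContinuousOn (u i a) (stdSimplex ℝ A)) ∧
  (∀ (a : A) (τ : A → ℝ), τ ∈ stdSimplex ℝ A → Measurable fun i => u i a τ)

/-- An atomless measure. -/
def MeasAtomless (lam : Measure I) : Prop :=
  ∀ s : Set I, MeasurableSet s → 0 < lam s →
    ∃ t : Set I, MeasurableSet t ∧ t ⊆ s ∧ 0 < lam t ∧ lam t < lam s

/-- A Borel probability measure concentrated on the simplex with full support on it. -/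
def FullSupportOnSimplex (η : Measure (A → ℝ)) : Prop :=
  IsProbabilityMeasure η ∧ η (stdSimplex ℝ A)ᶜ = 0 ∧
    ∀ U : Set (A → ℝ), IsOpen U → (U ∩ stdSimplex ℝ A).Nonempty → 0 < η U

/-- A perturbation function: a Borel measurable map from the simplex to the
full-support Borel probability measures on the simplex. -/
def IsPerturbation (φ : (A → ℝ) → Measure (A → ℝ)) : Prop :=
  (∀ τ ∈ stdSimplex ℝ A, FullSupportOnSimplex (φ τ)) ∧
  ∀ f : (A → ℝ) → ℝ, Continuous f → Measurable fun τ => ∫ x, f x ∂(φ τ)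

/-- Expected payoff of action `a` against a distribution over societal summaries. -/
noncomputable def payM (ui : A → (A → ℝ) → ℝ) (a : A) (ν : Measure (A → ℝ)) : ℝ :=
  ∫ τ, ui a τ ∂ν

/-- Randomized strategy Nash equilibrium. -/
def IsNash (lam : Measure I) (u : I → A → (A → ℝ) → ℝ) (h : I → A → ℝ) : Prop :=
  IsProfile lam h ∧
  ∀ᵐ i ∂lam, ∀ μ ∈ stdSimplex ℝ A,
    ∑ a, μ a * u i a (socSum lam h) ≤ ∑ a, h i a * u i a (socSum lam h)

/-- A weakly dominated action. -/
def WeaklyDominated (ui : A → (A → ℝ) → ℝ) (a : A) : Prop :=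
  ∃ μ ∈ stdSimplex ℝ A,
    (∀ τ ∈ stdSimplex ℝ A, ui a τ ≤ ∑ b, μ b * ui b τ) ∧
    (∃ τ ∈ stdSimplex ℝ A, ui a τ < ∑ b, μ b * ui b τ)

/-- Admissibility: almost no player puts weight on a weakly dominated action. -/
def Admissible (lam : Measure I) (u : I → A → (A → ℝ) → ℝ) (h : I → A → ℝ) : Prop :=
  ∀ᵐ i ∂lam, ∀ a : A, WeaklyDominated (u i) a → h i a = 0

/-- Weak convergence of a sequence of measures to a Dirac measure. -/
def WeakTendstoDirac (ν : ℕ → Measure (A → ℝ)) (τ : A → ℝ) : Prop :=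
  ∀ f : (A → ℝ) → ℝ, Continuous f →
    Tendsto (fun n => ∫ x, f x ∂(ν n)) atTop (nhds (f τ))

/-- Aggregate robustness. -/
def AggregateRobust (lam : Measure I) (u : I → A → (A → ℝ) → ℝ) (h : I → A → ℝ) : Prop :=
  ∀ᵐ i ∂lam, ∃ φ : ℕ → (A → ℝ) → Measure (A → ℝ),
    (∀ n, IsPerturbation (φ n)) ∧
    (∀ τ ∈ stdSimplex ℝ A, WeakTendstoDirac (fun n => φ n τ) τ) ∧
    ∀ n, ∀ μ ∈ stdSimplex ℝ A,
      ∑ a, μ a * payM (u i) a (φ n (socSum lam h)) ≤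
        ∑ a, h i a * payM (u i) a (φ n (socSum lam h))

/-- `ε`-robust perfect equilibrium with perturbed player space `Iε` and
perturbation function `φ`. -/
def IsEpsRPE (lam : Measure I) (u : I → A → (A → ℝ) → ℝ) (ε : ℝ)
    (h : I → A → ℝ) (Iε : Set I) (φ : (A → ℝ) → Measure (A → ℝ)) : Prop :=
  IsProfile lam h ∧
  (∀ᵐ i ∂lam, ∀ a : A, 0 < h i a) ∧
  MeasurableSet Iε ∧ ENNReal.ofReal (1 - ε) < lam Iε ∧
  IsPerturbation φ ∧
  (∀ τ ∈ stdSimplex ℝ A, ENNReal.ofReal (1 - ε) ≤ φ τ {τ}) ∧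
  ∀ i ∈ Iε, ∀ am al : A,
    payM (u i) am (φ (socSum lam h)) < payM (u i) al (φ (socSum lam h)) →
      h i am ≤ ε

/-- Robust perfect equilibrium. -/
def IsRPE (lam : Measure I) (u : I → A → (A → ℝ) → ℝ) (h : I → A → ℝ) : Prop :=
  IsProfile lam h ∧
  ∃ (ε : ℕ → ℝ) (hs : ℕ → I → A → ℝ) (Is : ℕ → Set I)
      (φs : ℕ → (A → ℝ) → Measure (A → ℝ)),
    (∀ n, 0 < ε n) ∧ Tendsto ε atTop (nhds 0) ∧
    (∀ n, IsEpsRPE lam u (ε n) (hs n) (Is n) (φs n)) ∧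
    (∀ᵐ i ∂lam, ∃ nk : ℕ → ℕ, StrictMono nk ∧ (∀ k, i ∈ Is (nk k)) ∧
      Tendsto (fun k => hs (nk k) i) atTop (nhds (h i))) ∧
    Tendsto (fun n => socSum lam (hs n)) atTop (nhds (socSum lam h))

/-- The Dirac randomized strategy profile induced by a pure strategy profile. -/
def diracProfile [DecidableEq A] (f : I → A) : I → A → ℝ :=
  fun i a => if a = f i then 1 else 0

end RobustPerfect

section Congestion

variable {E P : Type*} [Fintype E] [Fintype P] [DecidableEq E]

/-- The load of edge `e` under the path-flow `τ`. -/
def edgeLoad (edgeOf : P → Finset E) (τ : P → ℝ) (e : E) : ℝ :=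
  ∑ p : P, if e ∈ edgeOf p then τ p else 0

/-- The cost of path `p` under the path-flow `τ`. -/
def pathCost (edgeOf : P → Finset E) (C : E → ℝ → ℝ) (p : P) (τ : P → ℝ) : ℝ :=
  ∑ e ∈ edgeOf p, C e (edgeLoad edgeOf τ e)

/-- Nonnegative, continuous and monotone increasing edge cost functions on `[0,1]`. -/
def IsCongestionCost (C : E → ℝ → ℝ) : Prop :=
  ∀ e, ContinuousOn (C e) (Set.Icc (0:ℝ) 1) ∧ MonotoneOn (C e) (Set.Icc (0:ℝ) 1) ∧
    ∀ x ∈ Set.Icc (0:ℝ) 1, 0 ≤ C e x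

/-- The common payoff of the congestion game: the negative of the path cost. -/
def congPayoff (I : Type*) (edgeOf : P → Finset E) (C : E → ℝ → ℝ) :
    I → P → (P → ℝ) → ℝ :=
  fun _ p τ => -(pathCost edgeOf C p τ)

/-- The uniform distribution on the simplex: the normalized
`(card P - 1)`-dimensional Hausdorff measure restricted to the simplex. -/
noncomputable def unifSimplex (P : Type*) [Fintype P] : Measure (P → ℝ) :=
  (μH[(Fintype.card P : ℝ) - 1] (stdSimplex ℝ P))⁻¹ •
    (μH[(Fintype.card P : ℝ) - 1]).restrict (stdSimplex ℝ P)

/-- The perturbation function `τ ↦ (1-ε)δ_τ + ε η`. -/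
noncomputable def pertOf {A : Type*} [Fintype A] (ε : ℝ) (η : Measure (A → ℝ)) :
    (A → ℝ) → Measure (A → ℝ) :=
  fun τ => ENNReal.ofReal (1 - ε) • Measure.dirac τ + ENNReal.ofReal ε • η

end Congestion

section Atomless

variable {I : Type*} [MeasurableSpace I] {lam : Measure I}

/-- Sets of positive measure contain sets of arbitrarily small positive measure. -/
lemma MeasAtomless.exists_small_subset [IsFiniteMeasure lam] (hat : MeasAtomless lam) {s : Set I}
    (hs : MeasurableSet s) (hpos : 0 < lam.real s) {r : ℝ} (hr : 0 < r) :
    ∃ t, MeasurableSet t ∧ t ⊆ s ∧ 0 < lam.real t ∧ lam.real t ≤ r := by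
  have halving : ∀ n : ℕ, ∃ t, MeasurableSet t ∧ t ⊆ s ∧ 0 < lam.real t ∧
      lam.real t ≤ lam.real s * (1 / 2) ^ n := by
    intro n
    induction n with
    | zero => exact ⟨s, hs, subset_rfl, hpos, by simp⟩
    | succ n ih =>
      obtain ⟨t, ht, hts, htpos, htle⟩ := ih
      obtain ⟨v, hv, hvt, hvpos, hvlt⟩ := hat t ht (ENNReal.toReal_pos_iff.1 htpos).1
      have hvpos' : 0 < lam.real v := ENNReal.toReal_pos hvpos.ne' (measure_ne_top _ _)
      have hvlt' : lam.real v < lam.real t :=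
        (ENNReal.toReal_lt_toReal (measure_ne_top _ _) (measure_ne_top _ _)).2 hvlt
      have hdiff : lam.real (t \ v) = lam.real t - lam.real v := measureReal_sdiff hvt hv
      rw [pow_succ]
      rcases le_total (lam.real v) (lam.real t / 2) with h | h
      · exact ⟨v, hv, hvt.trans hts, hvpos', by linarith⟩
      · exact ⟨t \ v, ht.diff hv, Set.sdiff_subset.trans hts, by linarith, by linarith⟩
  obtain ⟨n, hn⟩ := exists_pow_lt_of_lt_one (div_pos hr hpos) (by norm_num : (1 / 2 : ℝ) < 1)
  obtain ⟨t, ht, hts, htpos, htle⟩ := halving n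
  refine ⟨t, ht, hts, htpos, htle.trans ?_⟩
  rw [lt_div_iff₀ hpos] at hn
  linarith

/-- A greedy enlargement of `a` inside `s` that captures at least half of the measure of any
admissible enlargement. -/
lemma exists_greedy_extension [IsFiniteMeasure lam] {s : Set I} {c : ℝ} {a : Set I}
    (ha : MeasurableSet a) (has : a ⊆ s) (hac : lam.real a ≤ c) :
    ∃ a', MeasurableSet a' ∧ a' ⊆ s ∧ lam.real a' ≤ c ∧ a ⊆ a' ∧
      ∀ b, MeasurableSet b → b ⊆ s \ a → lam.real a + lam.real b ≤ c →
        lam.real a + lam.real b / 2 ≤ lam.real a' := by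
  set S : Set ℝ := {x | ∃ b, MeasurableSet b ∧ b ⊆ s \ a ∧ lam.real a + lam.real b ≤ c ∧
    lam.real b = x}
  have hbdd : BddAbove S := ⟨c - lam.real a, by rintro x ⟨b, -, -, h, rfl⟩; linarith⟩
  obtain ⟨b, hb, hbs, hbc, hbmax⟩ : ∃ b, MeasurableSet b ∧ b ⊆ s \ a ∧
      lam.real a + lam.real b ≤ c ∧ sSup S / 2 ≤ lam.real b := by
    rcases le_or_gt (sSup S) 0 with h0 | h0
    · exact ⟨∅, .empty, Set.empty_subset _, by simpa using hac, by simp; linarith⟩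
    · have hne : S.Nonempty := ⟨0, ∅, .empty, Set.empty_subset _, by simpa using hac, by simp⟩
      obtain ⟨x, ⟨b, hb, hbs, hbc, rfl⟩, hx⟩ := exists_lt_of_lt_csSup hne (half_lt_self h0)
      exact ⟨b, hb, hbs, hbc, hx.le⟩
  have hunion : lam.real (a ∪ b) = lam.real a + lam.real b :=
    measureReal_union (Set.disjoint_left.2 fun x hxa hxb => (hbs hxb).2 hxa) hb
  refine ⟨a ∪ b, ha.union hb, Set.union_subset has (hbs.trans Set.sdiff_subset),
    hunion.le.trans hbc, Set.subset_union_left, fun b' hb' hbs' hbc' => ?_⟩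
  have := le_csSup hbdd ⟨b', hb', hbs', hbc', rfl⟩
  linarith

/-- Sierpiński's theorem: a finite atomless measure takes all intermediate values. -/
lemma MeasAtomless.exists_subset_measureReal_eq [IsFiniteMeasure lam]
    (hat : MeasAtomless lam) {s : Set I} (hs : MeasurableSet s) {c : ℝ} (hc0 : 0 ≤ c) (hcs : c ≤ lam.real s) :
    ∃ t, MeasurableSet t ∧ t ⊆ s ∧ lam.real t = c := by
  have hext : ∀ a : {a : Set I // MeasurableSet a ∧ a ⊆ s ∧ lam.real a ≤ c},
      ∃ a' : {a : Set I // MeasurableSet a ∧ a ⊆ s ∧ lam.real a ≤ c}, a.1 ⊆ a'.1 ∧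
        ∀ b, MeasurableSet b → b ⊆ s \ a.1 → lam.real a.1 + lam.real b ≤ c →
          lam.real a.1 + lam.real b / 2 ≤ lam.real a'.1 := by
    rintro ⟨a, ha, has, hac⟩
    obtain ⟨a', h1, h2, h3, h4, h5⟩ := exists_greedy_extension ha has hac
    exact ⟨⟨a', h1, h2, h3⟩, h4, h5⟩
  choose next hsub hgreedy using hext
  let A : ℕ → {a : Set I // MeasurableSet a ∧ a ⊆ s ∧ lam.real a ≤ c} := fun n =>
    Nat.rec ⟨∅, .empty, Set.empty_subset _, by simpa using hc0⟩ (fun _ a => next a) n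
  have hmono : Monotone fun n => (A n).1 := monotone_nat_of_le_succ fun n => hsub (A n)
  have hmeas : MeasurableSet (⋃ n, (A n).1) := .iUnion fun n => (A n).2.1
  have hlim : Tendsto (fun n => lam.real (A n).1) atTop (𝓝 (lam.real (⋃ n, (A n).1))) :=
    (ENNReal.tendsto_toReal (measure_ne_top _ _)).comp (tendsto_measure_iUnion_atTop hmono)
  have hle : lam.real (⋃ n, (A n).1) ≤ c := le_of_tendsto' hlim fun n => (A n).2.2.2
  have hss : (⋃ n, (A n).1) ⊆ s := Set.iUnion_subset fun n => (A n).2.2.1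
  refine ⟨_, hmeas, hss, hle.antisymm ?_⟩
  by_contra! hlt
  have hdiff : lam.real (s \ ⋃ n, (A n).1) = lam.real s - lam.real (⋃ n, (A n).1) :=
    measureReal_sdiff hss hmeas
  obtain ⟨b, hb, hbs, hbpos, hble⟩ := hat.exists_small_subset (hs.diff hmeas)
    (by linarith) (sub_pos.2 hlt)
  have hAle : ∀ n, lam.real (A n).1 ≤ lam.real (⋃ n, (A n).1) := fun n =>
    measureReal_mono (Set.subset_iUnion (fun n => (A n).1) n)
  have hgrow : ∀ n : ℕ, n * (lam.real b / 2) ≤ lam.real (A n).1 := by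
    intro n
    induction n with
    | zero => simp
    | succ n ih =>
      have := hgreedy (A n) b hb
        (hbs.trans (Set.sdiff_subset_sdiff_right (Set.subset_iUnion (fun n => (A n).1) n)))
        (by linarith [hAle n])
      push_cast
      change _ ≤ lam.real (next (A n)).1
      linarith
  obtain ⟨n, hn⟩ := exists_nat_gt (c / (lam.real b / 2))
  rw [div_lt_iff₀ (by positivity)] at hn
  linarith [hgrow n, (A n).2.2.2]

/-- Every distribution on a finite set is the law of a measurable map on an atomless space. -/
lemma MeasAtomless.exists_measurable_law {P : Type*} [Fintype P] [Nonempty P]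
    [MeasurableSpace P] [MeasurableSingletonClass P] [IsProbabilityMeasure lam]
    (hat : MeasAtomless lam) {w : P → ℝ} (hw : w ∈ stdSimplex ℝ P) :
    ∃ f : I → P, Measurable f ∧ ∀ p, lam.real (f ⁻¹' {p}) = w p := by
  classical
  have key : ∀ (S : Finset P) (s : Set I), MeasurableSet s → lam.real s = ∑ p ∈ S, w p →
      ∃ f : I → P, Measurable f ∧ ∀ p ∈ S, w p ≤ lam.real (s ∩ f ⁻¹' {p}) := by
    intro S
    induction S using Finset.induction_on with
    | empty => exact fun s _ _ => ⟨fun _ => Classical.arbitrary P, measurable_const, by simp⟩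
    | insert q S hq ih =>
      intro s hs hsum
      rw [Finset.sum_insert hq] at hsum
      obtain ⟨t, ht, hts, htq⟩ := hat.exists_subset_measureReal_eq hs (hw.1 q)
        (by linarith [Finset.sum_nonneg fun p (_ : p ∈ S) => hw.1 p])
      obtain ⟨f, hf, hfS⟩ := ih (s \ t) (hs.diff ht) (by rw [measureReal_sdiff hts ht]; linarith)
      refine ⟨t.piecewise (fun _ => q) f, measurable_const.piecewise ht hf, fun p hp => ?_⟩
      rcases Finset.mem_insert.1 hp with rfl | hp
      · rw [← htq]
        exact measureReal_mono fun i hi => ⟨hts hi, by simp [hi]⟩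
      · exact (hfS p hp).trans (measureReal_mono fun i hi => ⟨hi.1.1, by
          simpa [Set.piecewise, hi.1.2] using hi.2⟩)
  obtain ⟨f, hf, hle⟩ := key Finset.univ Set.univ .univ (by simp [hw.2])
  refine ⟨f, hf, ?_⟩
  have htotal : ∑ p, lam.real (f ⁻¹' {p}) = 1 := by
    rw [← measureReal_biUnion_finset (fun p _ q _ hpq => by
        simpa using Disjoint.preimage f (Set.disjoint_singleton.2 hpq))
      fun p _ => hf (measurableSet_singleton p)]
    convert probReal_univ (μ := lam)
    ext; simp
  have heq := (Finset.sum_eq_sum_iff_of_le (s := Finset.univ) (f := w)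
    (g := fun p => lam.real (f ⁻¹' {p})) fun p _ => by simpa using hle p (Finset.mem_univ p)).1
    (hw.2.trans htotal.symm)
  exact fun p => (heq p (Finset.mem_univ p)).symm

end Atomless

section Perturbation

variable {A : Type*} [Fintype A]

/-- A full-support probability measure on the simplex: the image of a Poisson law under a dense
sequence. -/
lemma exists_fullSupportOnSimplex [Nonempty A] :
    ∃ η : Measure (A → ℝ), FullSupportOnSimplex η := by
  classical
  have hne : Nonempty (stdSimplex ℝ A) :=
    ⟨⟨_, single_mem_stdSimplex ℝ (Classical.arbitrary A)⟩⟩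
  set x : ℕ → A → ℝ := fun n => (TopologicalSpace.denseSeq (stdSimplex ℝ A) n : A → ℝ)
  have hxm : Measurable x := measurable_from_nat
  refine ⟨(ProbabilityTheory.poissonMeasure 1).map x,
    Measure.isProbabilityMeasure_map hxm.aemeasurable, ?_, fun U hU hUne => ?_⟩
  · rw [Measure.map_apply hxm (isClosed_stdSimplex ℝ A).measurableSet.compl]
    convert measure_empty (μ := ProbabilityTheory.poissonMeasure 1)
    exact Set.eq_empty_of_forall_notMem fun n hn =>
      hn (TopologicalSpace.denseSeq (stdSimplex ℝ A) n).2
  · obtain ⟨y, hyU, hy⟩ := hUne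
    obtain ⟨n, hn⟩ := (TopologicalSpace.denseRange_denseSeq (stdSimplex ℝ A)).exists_mem_open
      (hU.preimage continuous_subtype_val) ⟨⟨y, hy⟩, hyU⟩
    rw [Measure.map_apply hxm hU.measurableSet]
    refine lt_of_lt_of_le ?_ (measure_mono (Set.singleton_subset_iff.2 hn))
    exact (ENNReal.toReal_pos_iff.1
      (ProbabilityTheory.poissonMeasure_real_singleton_pos n one_pos)).1

lemma FullSupportOnSimplex.ae_mem {η : Measure (A → ℝ)} (hη : FullSupportOnSimplex η) :
    ∀ᵐ τ ∂η, τ ∈ stdSimplex ℝ A := hη.2.1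

lemma FullSupportOnSimplex.integrable {η : Measure (A → ℝ)} (hη : FullSupportOnSimplex η)
    {f : (A → ℝ) → ℝ} (hf : ContinuousOn f (stdSimplex ℝ A)) : Integrable f η := by
  have := hη.1
  have h := hf.integrableOn_compact (μ := η) (isCompact_stdSimplex ℝ A)
  rwa [IntegrableOn, Measure.restrict_eq_self_of_ae_mem hη.ae_mem] at h

lemma integral_pertOf {η : Measure (A → ℝ)} (hη : FullSupportOnSimplex η) {ε : ℝ} (hε0 : 0 ≤ ε)
    (hε1 : ε ≤ 1) {f : (A → ℝ) → ℝ} (hf : ContinuousOn f (stdSimplex ℝ A)) (τ : A → ℝ) :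
    ∫ x, f x ∂(pertOf ε η τ) = (1 - ε) * f τ + ε * ∫ x, f x ∂η := by
  have hd : Integrable f (Measure.dirac τ) := integrable_dirac (by simp)
  rw [pertOf, integral_add_measure (hd.smul_measure ENNReal.ofReal_ne_top)
    ((hη.integrable hf).smul_measure ENNReal.ofReal_ne_top), integral_smul_measure,
    integral_smul_measure, integral_dirac, ENNReal.toReal_ofReal hε0,
    ENNReal.toReal_ofReal (by linarith), smul_eq_mul, smul_eq_mul]

lemma isPerturbation_pertOf {η : Measure (A → ℝ)} (hη : FullSupportOnSimplex η) {ε : ℝ}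
    (hε0 : 0 < ε) (hε1 : ε ≤ 1) : IsPerturbation (pertOf ε η) := by
  have := hη.1
  refine ⟨fun τ hτ => ⟨⟨?_⟩, ?_, fun U hU hne => ?_⟩, fun f hf => ?_⟩
  · simp only [pertOf, Measure.add_apply, Measure.smul_apply, measure_univ, smul_eq_mul, mul_one]
    rw [← ENNReal.ofReal_add (by linarith) hε0.le]
    simp
  · have hdirac : Measure.dirac τ (stdSimplex ℝ A)ᶜ = 0 := by simp [hτ]
    simp [pertOf, hη.2.1, hdirac]
  · simp only [pertOf, Measure.add_apply, Measure.smul_apply, smul_eq_mul]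
    exact lt_of_lt_of_le
      (ENNReal.mul_pos (ENNReal.ofReal_pos.2 hε0).ne' (hη.2.2 U hU hne).ne') le_add_self
  · simp_rw [integral_pertOf hη hε0.le hε1 hf.continuousOn]
    exact ((hf.measurable.const_mul _).add_const _)

lemma ofReal_le_pertOf_singleton (ε : ℝ) (η : Measure (A → ℝ)) (τ : A → ℝ) :
    ENNReal.ofReal (1 - ε) ≤ pertOf ε η τ {τ} := by
  simp [pertOf]

end Perturbation

section Potential

variable {E P : Type*} [Fintype P] [DecidableEq E]

lemma edgeLoad_mem_Icc (edgeOf : P → Finset E) {τ : P → ℝ} (hτ : τ ∈ stdSimplex ℝ P) (e : E) :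
    edgeLoad edgeOf τ e ∈ Set.Icc (0 : ℝ) 1 := by
  refine ⟨Finset.sum_nonneg fun p _ => ?_, hτ.2 ▸ Finset.sum_le_sum fun p _ => ?_⟩ <;>
    split_ifs <;> first | exact hτ.1 p | exact le_rfl

lemma continuous_edgeLoad (edgeOf : P → Finset E) (e : E) :
    Continuous fun τ : P → ℝ => edgeLoad edgeOf τ e := by
  unfold edgeLoad
  refine continuous_finsetSum _ fun p _ => ?_
  split_ifs <;> fun_prop

lemma continuousOn_pathCost (edgeOf : P → Finset E) {C : E → ℝ → ℝ}
    (hC : ∀ e, ContinuousOn (C e) (Set.Icc 0 1)) (p : P) :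
    ContinuousOn (pathCost edgeOf C p) (stdSimplex ℝ P) :=
  continuousOn_finsetSum _ fun e _ => (hC e).comp (continuous_edgeLoad edgeOf e).continuousOn
    fun _ hτ => edgeLoad_mem_Icc edgeOf hτ e

lemma edgeLoad_add_smul (edgeOf : P → Finset E) (τ v : P → ℝ) (t : ℝ) (e : E) :
    edgeLoad edgeOf (τ + t • v) e = edgeLoad edgeOf τ e + t * edgeLoad edgeOf v e := by
  simp only [edgeLoad, Finset.mul_sum, ← Finset.sum_add_distrib]
  refine Finset.sum_congr rfl fun p _ => ?_
  split_ifs <;> simp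

variable [Fintype E]

/-- The Beckmann potential with additional constant path costs `k`. -/
noncomputable def beckmann (edgeOf : P → Finset E) (D : E → ℝ → ℝ) (r : ℝ) (k : P → ℝ)
    (τ : P → ℝ) : ℝ :=
  r * ∑ e, (∫ x in (0 : ℝ)..edgeLoad edgeOf τ e, D e x) + ∑ p, k p * τ p

lemma continuous_beckmann (edgeOf : P → Finset E) {D : E → ℝ → ℝ} (hD : ∀ e, Continuous (D e))
    (r : ℝ) (k : P → ℝ) : Continuous (beckmann edgeOf D r k) := by
  refine (continuous_const.mul (continuous_finsetSum _ fun e _ => ?_)).add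
    (continuous_finsetSum _ fun p _ => by fun_prop)
  exact (intervalIntegral.continuous_primitive
    (fun a b => (hD e).intervalIntegrable a b) 0).comp (continuous_edgeLoad edgeOf e)

lemma sum_mul_edgeLoad (edgeOf : P → Finset E) (D : E → ℝ → ℝ) (τ v : P → ℝ) :
    ∑ e, D e (edgeLoad edgeOf τ e) * edgeLoad edgeOf v e =
      ∑ p, pathCost edgeOf D p τ * v p := by
  simp only [pathCost, Finset.sum_mul]
  conv_lhs => enter [2, e]; rw [edgeLoad.eq_def edgeOf v e, Finset.mul_sum]
  rw [Finset.sum_comm]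
  refine Finset.sum_congr rfl fun p _ => ?_
  simp [mul_ite, Finset.sum_ite_mem]

lemma hasDerivAt_beckmann (edgeOf : P → Finset E) {D : E → ℝ → ℝ} (hD : ∀ e, Continuous (D e))
    (r : ℝ) (k τ v : P → ℝ) :
    HasDerivAt (fun t : ℝ => beckmann edgeOf D r k (τ + t • v))
      (∑ p, (r * pathCost edgeOf D p τ + k p) * v p) 0 := by
  have hprim : ∀ e, HasDerivAt
      (fun t : ℝ => ∫ x in (0 : ℝ)..edgeLoad edgeOf (τ + t • v) e, D e x)
      (D e (edgeLoad edgeOf τ e) * edgeLoad edgeOf v e) 0 := by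
    intro e
    have hin : HasDerivAt (fun t : ℝ => edgeLoad edgeOf (τ + t • v) e)
        (edgeLoad edgeOf v e) 0 := by
      simp_rw [edgeLoad_add_smul]
      simpa using ((hasDerivAt_id (0 : ℝ)).mul_const (edgeLoad edgeOf v e)).const_add
        (edgeLoad edgeOf τ e)
    have hout := ((hD e).integral_hasStrictDerivAt 0
      (edgeLoad edgeOf (τ + (0 : ℝ) • v) e)).hasDerivAt
    simpa [Function.comp_def] using hout.comp (0 : ℝ) hin
  have hlin : ∀ p, HasDerivAt (fun t : ℝ => k p * (τ + t • v) p) (k p * v p) 0 := by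
    intro p
    simpa using (((hasDerivAt_id (0 : ℝ)).mul_const (v p)).const_add (τ p)).const_mul (k p)
  have h := ((HasDerivAt.fun_sum fun e (_ : e ∈ Finset.univ) => hprim e).const_mul r).add
    (HasDerivAt.fun_sum fun p (_ : p ∈ Finset.univ) => hlin p)
  rw [sum_mul_edgeLoad] at h
  refine h.congr_deriv ?_
  rw [Finset.mul_sum, ← Finset.sum_add_distrib]
  exact Finset.sum_congr rfl fun p _ => by ring

/-- A function whose right-sided values do not drop below the value at `0` has nonnegative
derivative there. -/
lemma HasDerivAt.nonneg_of_eventually_le {g : ℝ → ℝ} {g' : ℝ} (hg : HasDerivAt g g' 0)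
    (hle : ∀ᶠ t in 𝓝[>] (0 : ℝ), g 0 ≤ g t) : 0 ≤ g' := by
  have hslope := (hasDerivAt_iff_tendsto_slope.1 hg).mono_left
    (nhdsWithin_mono 0 (s := Set.Ioi 0) fun t ht => ne_of_gt ht)
  refine ge_of_tendsto hslope ?_
  filter_upwards [hle, self_mem_nhdsWithin] with t ht (ht0 : 0 < t)
  rw [slope_def_field]
  exact div_nonneg (by linarith) (by linarith)

/-- On the simplex with all weights at least `δ` there is a flow that puts weight `δ` on every
path whose perturbed cost is not minimal. -/
lemma exists_constrained_equilibrium [Nonempty P] (edgeOf : P → Finset E) {D : E → ℝ → ℝ}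
    (hD : ∀ e, Continuous (D e)) (r : ℝ) (k : P → ℝ) {δ : ℝ}
    (hδ0 : 0 ≤ δ) (hδ : δ ≤ (Fintype.card P : ℝ)⁻¹) :
    ∃ τ ∈ stdSimplex ℝ P, (∀ p, δ ≤ τ p) ∧ ∀ p q,
      r * pathCost edgeOf D q τ + k q < r * pathCost edgeOf D p τ + k p → τ p ≤ δ := by
  classical
  set K : Set (P → ℝ) := stdSimplex ℝ P ∩ {τ | ∀ p, δ ≤ τ p}
  have hclosed : IsClosed {τ : P → ℝ | ∀ p, δ ≤ τ p} := by
    simp only [Set.ofPred_forall]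
    exact isClosed_iInter fun p => isClosed_le continuous_const (continuous_apply p)
  have hKne : K.Nonempty := ⟨fun _ => (Fintype.card P : ℝ)⁻¹,
    ⟨fun _ => by positivity, by simp⟩, fun _ => hδ⟩
  obtain ⟨τ, hτ, hmin⟩ := ((isCompact_stdSimplex ℝ P).inter_right hclosed).exists_isMinOn hKne
    (continuous_beckmann edgeOf hD r k).continuousOn
  refine ⟨τ, hτ.1, hτ.2, fun p q hlt => ?_⟩
  by_contra! hp
  have hpq : q ≠ p := by rintro rfl; exact lt_irrefl _ hlt
  set v : P → ℝ := Pi.single q 1 - Pi.single p 1 with hv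
  have hderiv := hasDerivAt_beckmann edgeOf hD r k τ v
  have hnonneg := hderiv.nonneg_of_eventually_le <| by
    filter_upwards [Ioo_mem_nhdsGT (sub_pos.2 hp)] with t ht
    simp only [zero_smul, add_zero]
    have htp : t < τ p - δ := ht.2
    have hge : ∀ a, τ a - (if a = p then t else 0) ≤ (τ + t • v) a := by
      intro a
      have ht0 : 0 < t := ht.1
      simp only [hv, Pi.add_apply, Pi.smul_apply, Pi.sub_apply, Pi.single_apply, smul_eq_mul]
      split_ifs <;> linarith
    have hδle : ∀ a, δ ≤ (τ + t • v) a := by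
      refine fun a => le_trans ?_ (hge a)
      split_ifs with h
      · subst h; linarith
      · linarith [hτ.2 a]
    exact hmin ⟨⟨fun a => hδ0.trans (hδle a), by
      simp [hv, Finset.sum_add_distrib, ← Finset.mul_sum, hτ.1.2]⟩, hδle⟩
  simp [hv, mul_sub, Finset.sum_sub_distrib, Pi.single_apply] at hnonneg
  linarith

end Potential

section CommonPayoff

lemma socSum_diracProfile {A : Type*} [DecidableEq A] [MeasurableSpace A]
    [MeasurableSingletonClass A] {I : Type*} [MeasurableSpace I] {lam : Measure I} {f : I → A} (hf : Measurable f) :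
    socSum lam (diracProfile f) = fun a => lam.real (f ⁻¹' {a}) := by
  ext a
  rw [← integral_indicator_one (hf (measurableSet_singleton a)), socSum]
  refine integral_congr_ae (.of_forall fun i => ?_)
  by_cases h : f i = a
  · simp [diracProfile, h]
  · simp [diracProfile, h, Ne.symm h]

variable {A : Type*} [Fintype A]

/-- Full-support flows `σ n` converging to `τ` that put weight at most `ε n → 0` on the actions
that are not optimal for the common payoff `v` under the perturbation `φ n`. -/
structure IsApproxFlow (v : A → (A → ℝ) → ℝ) (τ : A → ℝ) (ε : ℕ → ℝ) (σ : ℕ → A → ℝ)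
    (φ : ℕ → (A → ℝ) → Measure (A → ℝ)) : Prop where
  eps_pos : ∀ n, 0 < ε n
  tendsto_eps : Tendsto ε atTop (𝓝 0)
  mem : ∀ n, σ n ∈ stdSimplex ℝ A
  pos : ∀ n a, 0 < σ n a
  isPerturbation : ∀ n, IsPerturbation (φ n)
  le_singleton : ∀ n, ∀ ρ ∈ stdSimplex ℝ A, ENNReal.ofReal (1 - ε n) ≤ φ n ρ {ρ}
  le_eps : ∀ n a b, payM v a (φ n (σ n)) < payM v b (φ n (σ n)) → σ n a ≤ ε n
  limit_mem : τ ∈ stdSimplex ℝ A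
  tendsto : Tendsto σ atTop (𝓝 τ)

variable {v : A → (A → ℝ) → ℝ} {τ : A → ℝ} {ε : ℕ → ℝ} {σ : ℕ → A → ℝ}
  {φ : ℕ → (A → ℝ) → Measure (A → ℝ)} {I : Type*} [MeasurableSpace I] {lam : Measure I}

lemma IsApproxFlow.shift (H : IsApproxFlow v τ ε σ φ) (N : ℕ) :
    IsApproxFlow v τ (fun n => ε (n + N)) (fun n => σ (n + N)) (fun n => φ (n + N)) where
  eps_pos _ := H.eps_pos _
  tendsto_eps := (tendsto_add_atTop_iff_nat N).2 H.tendsto_eps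
  mem _ := H.mem _
  pos _ := H.pos _
  isPerturbation _ := H.isPerturbation _
  le_singleton _ := H.le_singleton _
  le_eps _ := H.le_eps _
  limit_mem := H.limit_mem
  tendsto := (tendsto_add_atTop_iff_nat N).2 H.tendsto

lemma IsApproxFlow.isRPE_const [IsProbabilityMeasure lam] (H : IsApproxFlow v τ ε σ φ) :
    IsRPE lam (fun _ => v) (fun _ => τ) := by
  have hsoc : ∀ ρ : A → ℝ, socSum lam (fun _ => ρ) = ρ := fun ρ => by ext a; simp [socSum]
  refine ⟨⟨measurable_const, fun _ => H.limit_mem⟩, ε, fun n _ => σ n, fun _ => Set.univ, φ,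
    H.eps_pos, H.tendsto_eps, fun n => ⟨⟨measurable_const, fun _ => H.mem n⟩,
      .of_forall fun _ => H.pos n, .univ, ?_, H.isPerturbation n, H.le_singleton n, ?_⟩,
    .of_forall fun _ => ⟨id, strictMono_id, fun _ => Set.mem_univ _, H.tendsto⟩, ?_⟩
  · rw [measure_univ, ENNReal.ofReal_lt_one]
    linarith [H.eps_pos n]
  · rw [hsoc]
    exact fun _ _ => H.le_eps n
  · simpa only [hsoc] using H.tendsto

/-- Scaling factors tending to `1` for which the scaled limit stays below the flows. -/
lemma IsApproxFlow.exists_scaling (H : IsApproxFlow v τ ε σ φ) :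
    ∃ c : ℕ → ℝ, Tendsto c atTop (𝓝 1) ∧ ∀ n a, c n * τ a < σ n a := by
  refine ⟨fun n => 1 - (∑ a, |σ n a - τ a| / τ a) - ε n, ?_, fun n a => ?_⟩
  · have hsum : Tendsto (fun n => ∑ a, |σ n a - τ a| / τ a) atTop (𝓝 (∑ a : A, 0)) := by
      refine tendsto_finsetSum _ fun a _ => ?_
      have h := (((tendsto_pi_nhds.1 H.tendsto a).sub_const (τ a)).abs).div_const (τ a)
      simpa using h
    simpa using (hsum.const_sub 1).sub H.tendsto_eps
  · rcases (H.limit_mem.1 a).eq_or_lt with h0 | h0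
    · simpa [← h0] using H.pos n a
    · have hle : |σ n a - τ a| / τ a ≤ ∑ b, |σ n b - τ b| / τ b :=
        Finset.single_le_sum (f := fun b => |σ n b - τ b| / τ b)
          (fun b _ => div_nonneg (abs_nonneg _) (H.limit_mem.1 b)) (Finset.mem_univ a)
      rw [div_le_iff₀ h0] at hle
      have habs := neg_abs_le (σ n a - τ a)
      have hε := mul_pos (H.eps_pos n) h0
      nlinarith

variable [DecidableEq A] [MeasurableSpace A] [MeasurableSingletonClass A]

lemma isProfile_diracProfile {f : I → A} (hf : Measurable f) :
    IsProfile lam (diracProfile f) := by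
  refine ⟨measurable_pi_lambda _ fun a => ?_, fun i => ⟨fun a => ?_, by simp [diracProfile]⟩⟩
  · have hset : MeasurableSet {i | a = f i} := by
      simpa [Set.preimage, eq_comm] using hf (measurableSet_singleton a)
    exact Measurable.ite hset measurable_const measurable_const
  · unfold diracProfile
    split_ifs <;> norm_num

lemma integrable_diracProfile [IsFiniteMeasure lam] {f : I → A} (hf : Measurable f)
    (a : A) :
    Integrable (fun i => diracProfile f i a) lam := by
  refine Integrable.of_bound
    ((measurable_pi_iff.1 (isProfile_diracProfile (lam := lam) hf).1 a).aestronglyMeasurable) 1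
    (.of_forall fun i => ?_)
  unfold diracProfile
  split_ifs <;> simp

lemma IsApproxFlow.isRPE_diracProfile [IsProbabilityMeasure lam]
    (H : IsApproxFlow v τ ε σ φ) {f : I → A} (hf : Measurable f) (hlaw : ∀ a, lam.real (f ⁻¹' {a}) = τ a) :
    IsRPE lam (fun _ => v) (diracProfile f) := by
  obtain ⟨c, hc, hcτ⟩ := H.exists_scaling
  have hev : ∀ᶠ n in atTop, 0 ≤ c n ∧ ∀ a, 0 < τ a → ε n < σ n a :=
    (hc.eventually_const_le one_pos).and <| eventually_all.2 fun a => by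
      by_cases ha : 0 < τ a
      · filter_upwards [H.tendsto_eps.eventually_lt (tendsto_pi_nhds.1 H.tendsto a) ha]
          with n hn _ using hn
      · exact .of_forall fun n h => absurd h ha
  obtain ⟨N, hN⟩ := eventually_atTop.1 hev
  replace H := H.shift N
  replace hN : ∀ n, 0 ≤ c (n + N) ∧ ∀ a, 0 < τ a → ε (n + N) < σ (n + N) a :=
    fun n => hN _ (Nat.le_add_left N n)
  replace hcτ := fun n => hcτ (n + N)
  replace hc := (tendsto_add_atTop_iff_nat N).2 hc
  have hsoc : socSum lam (diracProfile f) = τ := (socSum_diracProfile hf).trans (funext hlaw)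
  have hprof := isProfile_diracProfile (lam := lam) hf
  set hs : ℕ → I → A → ℝ := fun n i => c (n + N) • (diracProfile f i - τ) + σ (n + N) with hhs
  have hhs_apply : ∀ n i a, hs n i a =
      c (n + N) * diracProfile f i a + (σ (n + N) a - c (n + N) * τ a) := by
    intro n i a
    simp only [hhs, Pi.add_apply, Pi.smul_apply, Pi.sub_apply, smul_eq_mul]
    ring
  have hs_pos : ∀ n i a, 0 < hs n i a := by
    intro n i a
    rw [hhs_apply]
    linarith [mul_nonneg (hN n).1 ((hprof.2 i).1 a), hcτ n a]
  have hs_prof : ∀ n, IsProfile lam (hs n) := by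
    refine fun n => ⟨((hprof.1.sub_const τ).const_smul (c (n + N))).add_const _,
      fun i => ⟨fun a => (hs_pos n i a).le, ?_⟩⟩
    simp only [hhs, Pi.add_apply, Pi.smul_apply, Pi.sub_apply, smul_eq_mul,
      Finset.sum_add_distrib, ← Finset.mul_sum, Finset.sum_sub_distrib, (hprof.2 i).2,
      H.limit_mem.2, (H.mem n).2]
    ring
  have hs_soc : ∀ n, socSum lam (hs n) = σ (n + N) := by
    intro n
    ext a
    have ha : ∫ i, diracProfile f i a ∂lam = τ a := congrFun hsoc a
    simp only [socSum, hhs_apply]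
    rw [integral_add ((integrable_diracProfile hf a).const_mul _) (integrable_const _),
      integral_const_mul, ha]
    simp
  have hsupp : ∀ᵐ i ∂lam, 0 < τ (f i) := by
    have hnull : ∀ a, τ a = 0 → ∀ᵐ i ∂lam, f i ≠ a := by
      intro a ha
      have h0 : lam (f ⁻¹' {a}) = 0 := by
        rw [← measureReal_eq_zero_iff, hlaw, ha]
      filter_upwards [measure_eq_zero_iff_ae_notMem.1 h0] with i hi using hi
    have hall : ∀ᵐ i ∂lam, ∀ a, τ a = 0 → f i ≠ a :=
      eventually_all.2 fun a => by
        by_cases ha : τ a = 0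
        · filter_upwards [hnull a ha] with i hi _ using hi
        · exact .of_forall fun _ h => absurd h ha
    filter_upwards [hall] with i hi
    exact (H.limit_mem.1 _).lt_of_ne fun h => hi _ h.symm rfl
  have hmeas : MeasurableSet {i | 0 < τ (f i)} :=
    measurableSet_lt measurable_const ((measurable_of_finite τ).comp hf)
  refine ⟨hprof, fun n => ε (n + N), hs, fun _ => {i | 0 < τ (f i)}, fun n => φ (n + N),
    H.eps_pos, H.tendsto_eps, fun n => ⟨hs_prof n, .of_forall fun i => hs_pos n i, hmeas, ?_,
      H.isPerturbation n, H.le_singleton n, fun i hi a b hab => ?_⟩, ?_, ?_⟩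
  · rw [(prob_compl_eq_zero_iff hmeas).1 hsupp, ENNReal.ofReal_lt_one]
    linarith [H.eps_pos n]
  · rw [hs_soc] at hab
    have hle := H.le_eps n a b hab
    have hne : a ≠ f i := by
      rintro rfl
      exact absurd ((hN n).2 _ hi) (not_lt.2 hle)
    rw [hhs_apply]
    simp only [diracProfile, hne, if_false, mul_zero, zero_add]
    linarith [mul_nonneg (hN n).1 (H.limit_mem.1 a)]
  · filter_upwards [hsupp] with i hi
    refine ⟨id, strictMono_id, fun _ => hi, ?_⟩
    have h := (hc.smul_const (diracProfile f i - τ)).add H.tendsto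
    simpa using h
  · simpa only [hs_soc, hsoc] using H.tendsto

end CommonPayoff

section Existence

variable {E P : Type*} [Fintype E] [Fintype P] [DecidableEq E] [Nonempty P]

lemma exists_perturbed_equilibrium (edgeOf : P → Finset E) {C : E → ℝ → ℝ}
    (hC : ∀ e, ContinuousOn (C e) (Set.Icc 0 1)) {η : Measure (P → ℝ)}
    (hη : FullSupportOnSimplex η) {ε : ℝ} (hε0 : 0 < ε) (hε1 : ε ≤ 1) :
    ∃ σ ∈ stdSimplex ℝ P, (∀ p, 0 < σ p) ∧ ∀ p q,
      payM (fun p τ => -pathCost edgeOf C p τ) p (pertOf ε η σ) <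
        payM (fun p τ => -pathCost edgeOf C p τ) q (pertOf ε η σ) → σ p ≤ ε := by
  have hcard : (1 : ℝ) ≤ Fintype.card P := by exact_mod_cast Fintype.card_pos
  have hδ : 0 < ε * (Fintype.card P : ℝ)⁻¹ := by positivity
  set D : E → ℝ → ℝ := fun e => Set.IccExtend zero_le_one ((Set.Icc 0 1).domRestrict (C e))
  have hD : ∀ e, Continuous (D e) := fun e => (hC e).domRestrict.Icc_extend'
  have hDC : ∀ p, ∀ τ ∈ stdSimplex ℝ P, pathCost edgeOf D p τ = pathCost edgeOf C p τ :=
    fun p τ hτ => Finset.sum_congr rfl fun e _ =>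
      Set.IccExtend_of_mem zero_le_one _ (edgeLoad_mem_Icc edgeOf hτ e)
  obtain ⟨σ, hσ, hpos, hmin⟩ := exists_constrained_equilibrium edgeOf hD (1 - ε)
    (fun p => -(ε * ∫ τ, -pathCost edgeOf C p τ ∂η)) hδ.le
    (mul_le_of_le_one_left (by positivity) hε1)
  refine ⟨σ, hσ, fun p => hδ.trans_le (hpos p), fun p q hlt => ?_⟩
  simp only [payM] at hlt
  rw [integral_pertOf hη hε0.le hε1 (continuousOn_pathCost edgeOf hC p).fun_neg,
    integral_pertOf hη hε0.le hε1 (continuousOn_pathCost edgeOf hC q).fun_neg] at hlt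
  refine (hmin p q ?_).trans (mul_le_of_le_one_right hε0.le (inv_le_one_of_one_le₀ hcard))
  rw [hDC p σ hσ, hDC q σ hσ]
  linarith

lemma exists_isApproxFlow (edgeOf : P → Finset E) {C : E → ℝ → ℝ}
    (hC : ∀ e, ContinuousOn (C e) (Set.Icc 0 1)) :
    ∃ τ ε σ φ, IsApproxFlow (fun p τ => -pathCost edgeOf C p τ) τ ε σ φ := by
  obtain ⟨η, hη⟩ := exists_fullSupportOnSimplex (A := P)
  set ε : ℕ → ℝ := fun n => 1 / ((n : ℝ) + 1) with hε
  have hε0 : ∀ n, 0 < ε n := fun n => Nat.one_div_pos_of_nat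
  have hε1 : ∀ n, ε n ≤ 1 := fun n => by
    rw [hε, div_le_one (by positivity)]
    linarith [n.cast_nonneg (α := ℝ)]
  choose σ hσ hpos hle using fun n =>
    exists_perturbed_equilibrium edgeOf hC hη (hε0 n) (hε1 n)
  obtain ⟨τ, hτ, ψ, hψ, hlim⟩ := (isCompact_stdSimplex ℝ P).tendsto_subseq hσ
  exact ⟨τ, ε ∘ ψ, σ ∘ ψ, fun n => pertOf (ε (ψ n)) η,
    { eps_pos := fun n => hε0 _
      tendsto_eps := tendsto_one_div_add_atTop_nhds_zero_nat.comp hψ.tendsto_atTop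
      mem := fun n => hσ _
      pos := fun n => hpos _
      isPerturbation := fun n => isPerturbation_pertOf hη (hε0 _) (hε1 _)
      le_singleton := fun n ρ _ => ofReal_le_pertOf_singleton _ _ _
      le_eps := fun n => hle _
      limit_mem := hτ
      tendsto := hlim }⟩

end Existence

/-- Every atomless congestion game possesses a symmetric
randomized strategy robust perfect equilibrium and a pure strategy robust
perfect equilibrium. -/
theorem statement6 {I : Type*} [MeasurableSpace I]
    {E P : Type*} [Fintype E] [Fintype P] [Nonempty P] [DecidableEq E] [DecidableEq P]
    [MeasurableSpace P] [MeasurableSingletonClass P]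
    (lam : Measure I) [IsProbabilityMeasure lam] (hatomless : MeasAtomless lam)
    (edgeOf : P → Finset E) (hedge : ∀ p, (edgeOf p).Nonempty)
    (C : E → ℝ → ℝ) (hC : IsCongestionCost C) :
    (∃ h : I → P → ℝ, IsRPE lam (congPayoff I edgeOf C) h ∧
      ∀ i i' : I, congPayoff I edgeOf C i = congPayoff I edgeOf C i' → h i = h i') ∧
    (∃ f : I → P, Measurable f ∧ IsRPE lam (congPayoff I edgeOf C) (diracProfile f)) := by
  obtain ⟨τ, ε, σ, φ, H⟩ := exists_isApproxFlow edgeOf fun e => (hC e).1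
  obtain ⟨f, hf, hlaw⟩ := hatomless.exists_measurable_law H.limit_mem
  exact ⟨⟨fun _ => τ, H.isRPE_const, fun _ _ _ => rfl⟩, f, hf, H.isRPE_diracProfile hf hlaw⟩
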